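/- arXiv:2410.11837 — 3 statements merged into one kernel-verified Lean document; each statement's English description precedes it below -/
import Mathlib

section
/- Let M = ⨁_{(i,k) : i,k ≥ 0, i+k ≤ d−1} PV^i⟨k⟩, where PV^i⟨k⟩ denotes a copy of PV^i labelled by k, and let T : M → M be the ℂ-linear map sending μ ∈ PV^i⟨k⟩ to ∂μ ∈ PV^{i−1}⟨k+1⟩ (and to 0 when i = 0). Then T∘T = 0, every divergence-free μ ∈ PV^i_∂ placed in the summand PV^i⟨0⟩ lies in ker T, and the induced map ⨁_{i=0}^{d−1} PV^i_∂ → ker T / im T is a ℂ-linear isomorphism. (This computes the cohomology of the complex of fields of minimal BCOV theory on ℂ^d with respect to the differential t∂.) -/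
/-!
Setup: the supercommutative algebra `A = ℂ[x_1,…,x_d] ⊗ Λ[ξ_1,…,ξ_d]`
of polynomial polyvector fields on `ℂ^d`, encoded by coefficients: an element
`f : PVA d` assigns to each finite set `S ⊆ Fin d` the polynomial coefficient
of the monomial `ξ_S` (the product of the `ξ_i`, `i ∈ S`, in increasing order).
-/

noncomputable section

namespace BCOV

/-- Polynomial coefficient ring `ℂ[x_1,…,x_d]`. -/
abbrev MPoly (d : ℕ) : Type := MvPolynomial (Fin d) ℂ

/-- The algebra `A` of polynomial polyvector fields on `ℂ^d`. -/
abbrev PVA (d : ℕ) : Type := Finset (Fin d) → MPoly d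

variable {d : ℕ}

/-- Koszul sign arising when multiplying `ξ_T · ξ_U` for disjoint `T`, `U`. -/
def koszulSign (T U : Finset (Fin d)) : ℂ :=
  (-1 : ℂ) ^ (((T ×ˢ U).filter fun p : (Fin d) × (Fin d) => p.2 < p.1).card)

/-- The supercommutative product on `A`. -/
def mul (f g : PVA d) : PVA d := fun S =>
  ∑ T ∈ S.powerset, koszulSign T (S \ T) • (f T * g (S \ T))

/-- The even partial derivative `∂/∂x_i`. -/
def Dx (i : Fin d) (f : PVA d) : PVA d := fun S => MvPolynomial.pderiv i (f S)

/-- The left odd partial derivative `∂/∂ξ_i`. -/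
def Dxi (i : Fin d) (f : PVA d) : PVA d := fun S =>
  if i ∈ S then 0
  else ((-1 : ℂ) ^ ((S.filter fun j => j < i).card)) • f (insert i S)

/-- The divergence operator `∂ = Σ_i ∂_{x_i} ∂_{ξ_i}` (with respect to the
standard holomorphic volume form). -/
def dvg (f : PVA d) : PVA d := ∑ i : Fin d, Dx i (Dxi i f)

/-- `f` lies in `PV^j`: only coefficients of `ξ`-monomials of length `j` occur. -/
def IsHomog (j : ℕ) (f : PVA d) : Prop :=
  ∀ S : Finset (Fin d), S.card ≠ j → f S = 0

/-- The Schouten–Nijenhuis bracket `[f, g]` of `f ∈ PV^a` with `g`: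
`[f,g] = (−1)^{a−1} (∂(fg) − (∂f)g − (−1)^a f (∂g))`. -/
def sn (a : ℕ) (f g : PVA d) : PVA d :=
  ((-1 : ℂ) ^ (a + 1)) •
    (dvg (mul f g) - mul (dvg f) g - ((-1 : ℂ) ^ a) • mul f (dvg g))

/-- The top polyvector field `ξ_1 ⋯ ξ_d`. -/
def xiTop : PVA d := fun S => if S = Finset.univ then 1 else 0

/-- `τ`: the value at `x = 0` of the coefficient of `ξ_1 ⋯ ξ_d`. -/
def tauA (f : PVA d) : ℂ := MvPolynomial.constantCoeff (f Finset.univ)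

/-- `σ`: the constant term. -/
def sigmaA (f : PVA d) : ℂ := MvPolynomial.constantCoeff (f ∅)

lemma Dx_add (i : Fin d) (f g : PVA d) : Dx i (f + g) = Dx i f + Dx i g := by
  funext S; simp [Dx]

lemma Dx_smul (i : Fin d) (c : ℂ) (f : PVA d) : Dx i (c • f) = c • Dx i f := by
  funext S; simp [Dx]

lemma Dxi_add (i : Fin d) (f g : PVA d) : Dxi i (f + g) = Dxi i f + Dxi i g := by
  funext S
  by_cases h : i ∈ S
  · simp [Dxi, h]
  · simp [Dxi, h, smul_add]

lemma Dxi_smul (i : Fin d) (c : ℂ) (f : PVA d) : Dxi i (c • f) = c • Dxi i f := by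
  funext S
  by_cases h : i ∈ S
  · simp [Dxi, h]
  · simp only [Dxi, if_neg h, Pi.smul_apply]
    rw [smul_comm]

lemma dvg_add (f g : PVA d) : dvg (f + g) = dvg f + dvg g := by
  simp [dvg, Dxi_add, Dx_add, Finset.sum_add_distrib]

lemma dvg_smul (c : ℂ) (f : PVA d) : dvg (c • f) = c • dvg f := by
  simp [dvg, Dxi_smul, Dx_smul, Finset.smul_sum]

/-- The divergence operator as a `ℂ`-linear endomorphism of `A`. -/
def dvgL (d : ℕ) : PVA d →ₗ[ℂ] PVA d where
  toFun := dvg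
  map_add' := dvg_add
  map_smul' := dvg_smul

lemma IsHomog.add {j : ℕ} {f g : PVA d} (hf : IsHomog j f) (hg : IsHomog j g) :
    IsHomog j (f + g) := fun S hS => by
  simp only [Pi.add_apply, hf S hS, hg S hS, add_zero]

lemma isHomog_zero {j : ℕ} : IsHomog j (0 : PVA d) := fun _ _ => rfl

lemma IsHomog.smul {j : ℕ} {f : PVA d} (c : ℂ) (hf : IsHomog j f) :
    IsHomog j (c • f) := fun S hS => by
  simp only [Pi.smul_apply, hf S hS, smul_zero]

/-- The subspace `PV^j ⊆ A` of `j`-polyvector fields. -/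
def PVsub (d j : ℕ) : Submodule ℂ (PVA d) where
  carrier := {f | IsHomog j f}
  add_mem' hf hg := hf.add hg
  zero_mem' := isHomog_zero
  smul_mem' c _ hf := hf.smul c

/-- The subspace `PV^j_∂ ⊆ A` of divergence-free `j`-polyvector fields. -/
def PVd (d j : ℕ) : Submodule ℂ (PVA d) := PVsub d j ⊓ LinearMap.ker (dvgL d)

/-- Ambient space containing `M = ⨁_{(i,k) : i+k ≤ d−1} PV^i⟨k⟩`: functions
`(i,k) ↦ (component in the copy PV^i⟨k⟩)`. -/
abbrev F8 (d : ℕ) := (ℕ × ℕ) → PVA d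

/-- The `ℂ`-linear map `T` sending `μ ∈ PV^i⟨k⟩` to `∂μ ∈ PV^{i−1}⟨k+1⟩`
(and to `0` when `i = 0`), in components. -/
def T8 (d : ℕ) : F8 d →ₗ[ℂ] F8 d where
  toFun m := fun p => if p.2 = 0 then 0 else dvg (m (p.1 + 1, p.2 - 1))
  map_add' m n := by
    funext p
    by_cases h : p.2 = 0 <;> simp [h, dvg_add]
  map_smul' c m := by
    funext p
    by_cases h : p.2 = 0 <;> simp [h, dvg_smul]

/-- The subspace `M = ⨁_{(i,k) : i,k ≥ 0, i+k ≤ d−1} PV^i⟨k⟩`. -/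
def M8 (d : ℕ) : Submodule ℂ (F8 d) where
  carrier := {m | ∀ p : ℕ × ℕ, IsHomog p.1 (m p) ∧ (d - 1 < p.1 + p.2 → m p = 0)}
  add_mem' := fun {f g} hf hg p => ⟨((hf p).1).add (hg p).1,
    fun h => by simp only [Pi.add_apply, (hf p).2 h, (hg p).2 h, add_zero]⟩
  zero_mem' := fun p => ⟨isHomog_zero, fun _ => rfl⟩
  smul_mem' := fun c f hf p => ⟨((hf p).1).smul c,
    fun h => by simp only [Pi.smul_apply, (hf p).2 h, smul_zero]⟩

/-- The placement of a single `μ ∈ PV^i` into the summand `PV^i⟨0⟩ ⊆ M`. -/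
def singIncl (d : ℕ) (i : ℕ) (μ : PVA d) : F8 d :=
  fun p => if p = (i, 0) then μ else 0

/-- `N = ⨁_{i=0}^{d−1} PV^i_∂`. -/
abbrev N8 (d : ℕ) := ∀ j : Fin d, ↥(PVd d j)

/-- The inclusion `N → M` placing each `PV^i_∂` into `PV^i⟨0⟩`. -/
def nIncl (d : ℕ) (n : N8 d) : F8 d :=
  fun p => if h : p.2 = 0 ∧ p.1 < d then (n ⟨p.1, h.2⟩ : PVA d) else 0

/-- The cohomology `ker T / im T` of `(M, T)`. -/
abbrev Coh8 (d : ℕ) :=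
  ↥(M8 d ⊓ LinearMap.ker (T8 d)) ⧸
    (Submodule.comap (M8 d ⊓ LinearMap.ker (T8 d)).subtype
      (Submodule.map (T8 d) (M8 d)))

/-- The sign acquired when `ξ_i` is moved to its place in the monomial `ξ_S`. -/
def xiSign (i : Fin d) (S : Finset (Fin d)) : ℂ :=
  (-1 : ℂ) ^ ((S.filter fun j => j < i).card)

lemma xiSign_mul_self (i : Fin d) (S : Finset (Fin d)) : xiSign i S * xiSign i S = 1 := by
  rw [xiSign, ← mul_pow]; simp

lemma xiSign_insert (i : Fin d) {j : Fin d} {S : Finset (Fin d)} (hj : j ∉ S) :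
    xiSign i (insert j S) = if j < i then -xiSign i S else xiSign i S := by
  unfold xiSign
  rw [Finset.filter_insert]
  split_ifs with h
  · rw [Finset.card_insert_of_notMem (by simp [hj]), pow_succ]; ring
  · rfl

lemma Dxi_apply (i : Fin d) (f : PVA d) (S : Finset (Fin d)) :
    Dxi i f S = if i ∈ S then 0 else xiSign i S • f (insert i S) := rfl

lemma Dx_apply (i : Fin d) (f : PVA d) (S : Finset (Fin d)) :
    Dx i f S = MvPolynomial.pderiv i (f S) := rfl

lemma dvg_apply (f : PVA d) (S : Finset (Fin d)) :
    dvg f S = ∑ i, MvPolynomial.pderiv i (Dxi i f S) := by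
  simp [dvg, Dx_apply]

lemma dvg_zero : dvg (0 : PVA d) = 0 := (dvgL d).map_zero

lemma Dxi_Dxi_self (i : Fin d) (f : PVA d) : Dxi i (Dxi i f) = 0 := by
  funext S
  simp [Dxi_apply]

lemma Dxi_anticomm (i j : Fin d) (f : PVA d) : Dxi i (Dxi j f) = -Dxi j (Dxi i f) := by
  rcases eq_or_ne i j with rfl | hij
  · simp [Dxi_Dxi_self]
  funext S
  simp only [Dxi_apply, Pi.neg_apply, Finset.mem_insert, hij, hij.symm, false_or]
  by_cases hi : i ∈ S
  · simp [hi]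
  by_cases hj : j ∈ S
  · simp [hj]
  simp only [hi, hj, if_false, xiSign_insert j hi, xiSign_insert i hj, Finset.insert_comm i j,
    smul_smul, ← neg_smul]
  congr 1
  rcases lt_or_gt_of_ne hij with h | h <;> simp [h, h.not_gt] <;> ring

lemma Dxi_Dx (i j : Fin d) (f : PVA d) : Dxi i (Dx j f) = Dx j (Dxi i f) := by
  funext S
  simp only [Dxi_apply, Dx_apply]
  split_ifs <;> simp

lemma Dx_comm (i j : Fin d) (f : PVA d) : Dx i (Dx j f) = Dx j (Dx i f) := by
  funext S
  simp only [Dx_apply]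
  have h : ⁅(MvPolynomial.pderiv i : Derivation ℂ (MPoly d) (MPoly d)),
      (MvPolynomial.pderiv j : Derivation ℂ (MPoly d) (MPoly d))⁆ = 0 := by
    refine MvPolynomial.derivation_ext fun k => ?_
    rcases eq_or_ne k i with rfl | hi <;> rcases eq_or_ne k j with rfl | hj <;>
      simp_all [Derivation.commutator_apply]
  have h2 := congrArg (fun D : Derivation ℂ (MPoly d) (MPoly d) => D (f S)) h
  simpa [Derivation.commutator_apply, sub_eq_zero] using h2

lemma Dx_neg (i : Fin d) (f : PVA d) : Dx i (-f) = -Dx i f := by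
  funext S; simp [Dx_apply]

lemma dvg_eq_sum (f : PVA d) : dvg f = ∑ i, Dx i (Dxi i f) := rfl

lemma Dx_Dxi_dvg (i : Fin d) (f : PVA d) :
    Dx i (Dxi i (dvg f)) = ∑ j, Dx i (Dxi i (Dx j (Dxi j f))) :=
  map_sum (⟨⟨fun g => Dx i (Dxi i g), fun g h => by rw [Dxi_add, Dx_add]⟩,
    fun c g => by simp [Dxi_smul, Dx_smul]⟩ : PVA d →ₗ[ℂ] PVA d) _ _

lemma dvg_dvg (f : PVA d) : dvg (dvg f) = 0 := by
  have h : dvg (dvg f) = ∑ i, ∑ j, Dx i (Dxi i (Dx j (Dxi j f))) := by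
    rw [dvg_eq_sum (dvg f)]
    exact Finset.sum_congr rfl fun i _ => Dx_Dxi_dvg i f
  have h' : dvg (dvg f) = -dvg (dvg f) := by
    conv_rhs => rw [h, Finset.sum_comm]
    rw [h]
    simp only [← Finset.sum_neg_distrib]
    refine Finset.sum_congr rfl fun i _ => Finset.sum_congr rfl fun j _ => ?_
    rw [Dxi_Dx, Dxi_Dx, Dx_comm, Dxi_anticomm, Dx_neg, Dx_neg]
  exact self_eq_neg.mp h'

lemma IsHomog.dvg {j : ℕ} {f : PVA d} (hf : IsHomog (j + 1) f) : IsHomog j (dvg f) := by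
  intro S hS
  rw [dvg_apply]
  refine Finset.sum_eq_zero fun i _ => ?_
  rw [Dxi_apply]
  split_ifs with h
  · simp
  · rw [hf _ (by rw [Finset.card_insert_of_notMem h]; omega)]; simp

lemma dvg_of_isHomog_zero {f : PVA d} (hf : IsHomog 0 f) : dvg f = 0 := by
  funext S
  rw [dvg_apply]
  refine Finset.sum_eq_zero fun i _ => ?_
  rw [Dxi_apply]
  split_ifs with h
  · simp
  · rw [hf _ (by simp)]; simp

/-- Multiplication by `x_i ξ_i` on the left. -/
def mulXXi (i : Fin d) (f : PVA d) : PVA d := fun S =>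
  if i ∈ S then xiSign i (S.erase i) • (MvPolynomial.X i * f (S.erase i)) else 0

lemma mulXXi_apply (i : Fin d) (f : PVA d) (S : Finset (Fin d)) :
    mulXXi i f S =
      if i ∈ S then xiSign i (S.erase i) • (MvPolynomial.X i * f (S.erase i)) else 0 := rfl

lemma Dx_Dxi_mulXXi_self (i : Fin d) (f : PVA d) (S : Finset (Fin d)) :
    Dx i (Dxi i (mulXXi i f)) S + mulXXi i (Dx i (Dxi i f)) S =
      MvPolynomial.X i * MvPolynomial.pderiv i (f S) + if i ∈ S then 0 else f S := by
  simp only [mulXXi_apply, Dx_apply, Dxi_apply]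
  by_cases h : i ∈ S
  · simp [h, Finset.insert_erase h, smul_smul, xiSign_mul_self]
  · simp [h, smul_smul, xiSign_mul_self, add_comm]

lemma Dx_Dxi_mulXXi_of_ne {i j : Fin d} (hij : i ≠ j) (f : PVA d) (S : Finset (Fin d)) :
    Dx i (Dxi i (mulXXi j f)) S + mulXXi j (Dx i (Dxi i f)) S = 0 := by
  simp only [mulXXi_apply, Dx_apply, Dxi_apply]
  by_cases hj : j ∈ S
  swap
  · simp [hj, hij.symm]
  by_cases hi : i ∈ S
  · simp [hi, hj, hij]
  obtain ⟨U, hU, rfl⟩ : ∃ U, j ∉ U ∧ S = insert j U :=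
    ⟨S.erase j, by simp, (Finset.insert_erase hj).symm⟩
  have hiU : i ∉ U := fun h => hi (Finset.mem_insert_of_mem h)
  have hjU : j ∉ insert i U := by simp [hij.symm, hU]
  have hX : MvPolynomial.pderiv i (MvPolynomial.X j * f (insert i U)) =
      MvPolynomial.X j * MvPolynomial.pderiv i (f (insert i U)) := by
    simp [Derivation.leibniz, MvPolynomial.pderiv_X_of_ne hij.symm]
  simp only [hi, Finset.insert_comm i j, Finset.erase_insert hjU, Finset.erase_insert hU,
    Finset.mem_insert_self, if_true, if_false, hiU, xiSign_insert i hU, xiSign_insert j hiU,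
    Derivation.map_smul, hX, mul_smul_comm, smul_smul]
  rw [← add_smul]
  refine smul_eq_zero_of_left ?_ _
  rcases lt_or_gt_of_ne hij with h | h <;> simp [h, h.not_gt] <;> ring

/-- Left multiplication by `Σ_i x_i ξ_i`. -/
def koszulHomotopy (f : PVA d) : PVA d := ∑ i, mulXXi i f

lemma koszulHomotopy_zero : koszulHomotopy (0 : PVA d) = 0 := by
  funext S; simp [koszulHomotopy, mulXXi_apply]

lemma IsHomog.koszulHomotopy {j : ℕ} {f : PVA d} (hf : IsHomog j f) :
    IsHomog (j + 1) (koszulHomotopy f) := by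
  intro S hS
  rw [BCOV.koszulHomotopy, Finset.sum_apply]
  refine Finset.sum_eq_zero fun i _ => ?_
  rw [mulXXi_apply]
  split_ifs with h
  · have := Finset.card_erase_add_one h
    rw [hf _ (by omega)]; simp
  · rfl

/-- The operator `Σ_i x_i ∂_{x_i} + c` on polynomials. -/
def eulerAdd (d c : ℕ) : MPoly d →ₗ[ℂ] MPoly d :=
  ∑ i, (LinearMap.mulLeft ℂ (MvPolynomial.X i)).comp
    (MvPolynomial.pderiv i : Derivation ℂ (MPoly d) (MPoly d)).toLinearMap + (c : ℂ) • LinearMap.id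

lemma eulerAdd_apply (c : ℕ) (p : MPoly d) :
    eulerAdd d c p = ∑ i, MvPolynomial.X i * MvPolynomial.pderiv i p + (c : ℂ) • p := by
  simp [eulerAdd]

lemma eulerAdd_monomial (c : ℕ) (m : Fin d →₀ ℕ) (a : ℂ) :
    eulerAdd d c (MvPolynomial.monomial m a) =
      ((∑ i, m i + c : ℕ) : ℂ) • MvPolynomial.monomial m a := by
  rw [eulerAdd_apply]
  simp only [MvPolynomial.X_mul_pderiv_monomial]
  rw [← Finset.sum_smul, Nat.cast_add, add_smul, Nat.cast_smul_eq_nsmul ℂ (∑ i, m i)]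

lemma coeff_eulerAdd (c : ℕ) (p : MPoly d) (m : Fin d →₀ ℕ) :
    (eulerAdd d c p).coeff m = ((∑ i, m i + c : ℕ) : ℂ) * p.coeff m := by
  induction p using MvPolynomial.induction_on' with
  | monomial n a =>
    rw [eulerAdd_monomial, MvPolynomial.coeff_smul, MvPolynomial.coeff_monomial, smul_eq_mul]
    split_ifs with h
    · rw [h]
    · simp
  | add p q hp hq => rw [map_add, MvPolynomial.coeff_add, hp, hq, MvPolynomial.coeff_add, mul_add]

lemma eulerAdd_injective {c : ℕ} (hc : 0 < c) : Function.Injective (eulerAdd d c) := by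
  intro p q h
  ext m
  have hm := congrArg (MvPolynomial.coeff m) h
  rw [coeff_eulerAdd, coeff_eulerAdd] at hm
  exact mul_left_cancel₀ (Nat.cast_ne_zero.mpr (by omega)) hm

lemma eulerAdd_surjective {c : ℕ} (hc : 0 < c) : Function.Surjective (eulerAdd d c) := by
  intro p
  induction p using MvPolynomial.induction_on' with
  | monomial n a =>
    refine ⟨((∑ i, n i + c : ℕ) : ℂ)⁻¹ • MvPolynomial.monomial n a, ?_⟩
    rw [map_smul, eulerAdd_monomial, inv_smul_smul₀ (Nat.cast_ne_zero.mpr (by omega))]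
  | add p q hp hq =>
    obtain ⟨p', rfl⟩ := hp
    obtain ⟨q', rfl⟩ := hq
    exact ⟨p' + q', map_add _ _ _⟩

lemma dvg_koszulHomotopy_add (f : PVA d) (S : Finset (Fin d)) :
    (dvg (koszulHomotopy f) + koszulHomotopy (dvg f)) S = eulerAdd d (d - S.card) (f S) := by
  have h1 : dvg (koszulHomotopy f) = ∑ j, ∑ i, Dx i (Dxi i (mulXXi j f)) :=
    map_sum (dvgL d) _ _
  have h2 : koszulHomotopy (dvg f) = ∑ j, ∑ i, mulXXi j (Dx i (Dxi i f)) := by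
    refine Finset.sum_congr rfl fun j _ => ?_
    funext U
    simp only [mulXXi_apply, dvg_eq_sum, Finset.sum_apply]
    split_ifs
    · rw [Finset.mul_sum, Finset.smul_sum]
    · simp
  rw [h1, h2]
  simp only [Pi.add_apply, Finset.sum_apply, ← Finset.sum_add_distrib]
  have h3 : ∀ j, ∑ i, (Dx i (Dxi i (mulXXi j f)) S + mulXXi j (Dx i (Dxi i f)) S) =
      MvPolynomial.X j * MvPolynomial.pderiv j (f S) + if j ∈ S then 0 else f S := by
    intro j
    rw [Finset.sum_eq_single j (fun i _ hij => Dx_Dxi_mulXXi_of_ne hij f S) (by simp),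
      Dx_Dxi_mulXXi_self]
  simp only [h3, Finset.sum_add_distrib, eulerAdd_apply]
  congr 1
  have h4 : ∀ j, (if j ∈ S then 0 else f S) = if j ∈ Sᶜ then f S else 0 := by
    intro j; by_cases h : j ∈ S <;> simp [h]
  simp only [h4]
  rw [Finset.sum_ite_mem, Finset.univ_inter, Finset.sum_const, Finset.card_compl,
    Fintype.card_fin, Nat.cast_smul_eq_nsmul]

/-- Polynomial Poincaré lemma: below top degree, divergence-free polyvector fields are
divergences. -/
lemma exists_dvg_eq {j : ℕ} (hj : j < d) {f : PVA d} (hf : IsHomog j f) (hf0 : dvg f = 0) :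
    ∃ g, IsHomog (j + 1) g ∧ dvg g = f := by
  choose r hr using eulerAdd_surjective (d := d) (Nat.sub_pos_of_lt hj)
  set g : PVA d := fun S => if S.card = j then r (f S) else 0 with hg
  have hgj : IsHomog j g := fun S hS => by simp [hg, hS]
  have hLg : dvg (koszulHomotopy g) + koszulHomotopy (dvg g) = f := by
    funext S
    rw [dvg_koszulHomotopy_add]
    by_cases hS : S.card = j
    · simp [hg, hS, hr]
    · simp [hg, hS, hf S hS]
  have hdg : dvg g = 0 := by
    rcases j with _ | j
    · exact dvg_of_isHomog_zero hgj
    have hc : dvg (koszulHomotopy (dvg g)) = 0 := by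
      rw [← hf0, ← hLg, dvg_add, dvg_dvg, zero_add]
    funext S
    by_cases hS : S.card = j
    · have h := dvg_koszulHomotopy_add (dvg g) S
      rw [hc, dvg_dvg, koszulHomotopy_zero] at h
      exact eulerAdd_injective (by omega) (h.symm.trans (by simp))
    · exact hgj.dvg S hS
  exact ⟨koszulHomotopy g, hgj.koszulHomotopy, by rw [← hLg, hdg, koszulHomotopy_zero, add_zero]⟩

lemma T8_apply (m : F8 d) (p : ℕ × ℕ) :
    T8 d m p = if p.2 = 0 then 0 else dvg (m (p.1 + 1, p.2 - 1)) := rfl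

lemma T8_mem {m : F8 d} (hm : m ∈ M8 d) : T8 d m ∈ M8 d := by
  rintro ⟨i, k⟩
  rw [T8_apply]
  split_ifs with h
  · exact ⟨isHomog_zero, fun _ => rfl⟩
  · refine ⟨(hm (i + 1, k - 1)).1.dvg, fun hik => ?_⟩
    dsimp only at h hik ⊢
    rw [(hm (i + 1, k - 1)).2 (by dsimp only; omega), dvg_zero]

lemma T8_comp_T8 : (T8 d).comp (T8 d) = 0 := by
  refine LinearMap.ext fun m => funext fun p => ?_
  rw [LinearMap.comp_apply, T8_apply]
  split_ifs
  · rfl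
  · rw [T8_apply]
    split_ifs
    · exact dvg_zero
    · exact dvg_dvg _

lemma T8_eq_zero_iff {m : F8 d} (hm : m ∈ M8 d) : T8 d m = 0 ↔ ∀ p, dvg (m p) = 0 := by
  constructor
  · rintro h ⟨_ | i, k⟩
    · exact dvg_of_isHomog_zero (hm (0, k)).1
    · simpa [T8_apply] using congrFun h (i, k + 1)
  · intro h
    funext p
    simp [T8_apply, h]

lemma singIncl_mem {i : ℕ} (hi : i ≤ d - 1) {μ : PVA d} (hμ : IsHomog i μ) (hμ0 : dvg μ = 0) :
    singIncl d i μ ∈ M8 d ⊓ LinearMap.ker (T8 d) := by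
  have hM : singIncl d i μ ∈ M8 d := by
    intro p
    rw [singIncl]
    split_ifs with h
    · subst h
      exact ⟨hμ, fun h => by dsimp only at h; omega⟩
    · exact ⟨isHomog_zero, fun _ => rfl⟩
  refine ⟨hM, (T8_eq_zero_iff hM).mpr fun p => ?_⟩
  rw [singIncl]
  split_ifs
  · exact hμ0
  · exact dvg_zero

lemma nIncl_mem (n : N8 d) : nIncl d n ∈ M8 d ⊓ LinearMap.ker (T8 d) := by
  have hM : nIncl d n ∈ M8 d := by
    intro p
    rw [nIncl]
    split_ifs with h
    · exact ⟨(n ⟨p.1, h.2⟩).2.1, fun h' => by omega⟩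
    · exact ⟨isHomog_zero, fun _ => rfl⟩
  refine ⟨hM, (T8_eq_zero_iff hM).mpr fun p => ?_⟩
  rw [nIncl]
  split_ifs with h
  · exact (n ⟨p.1, h.2⟩).2.2
  · exact dvg_zero

/-- The inclusion of `N` into the cocycles of `(M, T)`, as a linear map. -/
def nInclL (d : ℕ) : N8 d →ₗ[ℂ] ↥(M8 d ⊓ LinearMap.ker (T8 d)) where
  toFun n := ⟨nIncl d n, nIncl_mem n⟩
  map_add' m n := by
    ext1; funext p
    by_cases h : p.2 = 0 ∧ p.1 < d <;> simp [nIncl, h]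
  map_smul' c n := by
    ext1; funext p
    by_cases h : p.2 = 0 ∧ p.1 < d <;> simp [nIncl, h]

lemma eq_zero_of_nIncl_eq_T8 {n : N8 d} {m : F8 d} (h : T8 d m = nIncl d n) : n = 0 := by
  funext j
  ext1
  simpa [T8_apply, nIncl] using (congrFun h (j.1, 0)).symm

/-- A cocycle without components in the summands `PV^i⟨0⟩` is a coboundary. -/
lemma exists_T8_eq {m : F8 d} (hm : m ∈ M8 d) (hT : T8 d m = 0) (h0 : ∀ i, m (i, 0) = 0) :
    ∃ g ∈ M8 d, T8 d g = m := by
  have key : ∀ i k : ℕ, ∃ g : PVA d, IsHomog (i + 1) g ∧ (d - 1 < i + 1 + k → g = 0) ∧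
      dvg g = m (i, k + 1) := by
    intro i k
    by_cases hik : d - 1 < i + 1 + k
    · exact ⟨0, isHomog_zero, fun _ => rfl, by
        rw [dvg_zero, (hm (i, k + 1)).2 (by dsimp only; omega)]⟩
    · obtain ⟨g, hg, hgm⟩ := exists_dvg_eq (j := i) (by omega) (hm (i, k + 1)).1
        ((T8_eq_zero_iff hm).mp hT _)
      exact ⟨g, hg, fun h => absurd h hik, hgm⟩
  choose G hG1 hG2 hG3 using key
  refine ⟨fun p => if p.1 = 0 then 0 else G (p.1 - 1) p.2, ?_, ?_⟩
  · rintro ⟨_ | i, k⟩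
    · exact ⟨isHomog_zero, fun _ => rfl⟩
    · exact ⟨hG1 i k, hG2 i k⟩
  · funext ⟨i, k⟩
    rcases k with _ | k
    · simp [T8_apply, h0]
    · simp [T8_apply, hG3]

/-- With `M = ⨁_{(i,k) : i,k ≥ 0, i+k ≤ d−1} PV^i⟨k⟩` and
`T : M → M` sending `μ ∈ PV^i⟨k⟩` to `∂μ ∈ PV^{i−1}⟨k+1⟩` (and to `0` when
`i = 0`): `T∘T = 0`, every divergence-free `μ ∈ PV^i_∂` placed in the summand
`PV^i⟨0⟩` lies in `ker T`, and the induced map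
`⨁_{i=0}^{d−1} PV^i_∂ → ker T / im T` is a `ℂ`-linear isomorphism.  (This
computes the cohomology of the complex of fields of minimal BCOV theory on
`ℂ^d` with respect to the differential `t∂`.) -/
theorem minimal_bcov_cohomology (d : ℕ) (hd : 1 ≤ d) :
    (∀ m ∈ M8 d, T8 d m ∈ M8 d) ∧
    (T8 d).comp (T8 d) = 0 ∧
    (∀ i : ℕ, i ≤ d - 1 → ∀ μ : PVA d, IsHomog i μ → dvg μ = 0 →
      singIncl d i μ ∈ M8 d ⊓ LinearMap.ker (T8 d)) ∧
    ∃ φ : N8 d →ₗ[ℂ] Coh8 d, Function.Bijective φ ∧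
      ∀ n : N8 d, ∃ h : nIncl d n ∈ M8 d ⊓ LinearMap.ker (T8 d),
        φ n = Submodule.Quotient.mk ⟨nIncl d n, h⟩ := by
  refine ⟨fun m hm => T8_mem hm, T8_comp_T8, fun i hi μ hμ hμ0 => singIncl_mem hi hμ hμ0,
    (Submodule.mkQ _).comp (nInclL d), ⟨?_, ?_⟩, fun n => ⟨nIncl_mem n, rfl⟩⟩
  · rw [injective_iff_map_eq_zero]
    intro n hn
    obtain ⟨m, -, hm⟩ := (Submodule.Quotient.mk_eq_zero _).mp hn
    exact eq_zero_of_nIncl_eq_T8 hm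
  · intro q
    obtain ⟨⟨m, hm, hmT⟩, rfl⟩ := Submodule.Quotient.mk_surjective _ q
    let n : N8 d := fun j => ⟨m (j, 0), (hm (j, 0)).1, (T8_eq_zero_iff hm).mp hmT _⟩
    refine ⟨n, (Submodule.Quotient.eq _).mpr ?_⟩
    have hsub := sub_mem (nIncl_mem n) (⟨hm, hmT⟩ : m ∈ M8 d ⊓ LinearMap.ker (T8 d))
    obtain ⟨g, hg, hgT⟩ := exists_T8_eq hsub.1 hsub.2 fun i => by
      by_cases hi : i < d
      · simp [nIncl, n, hi]
      · have hmi : m (i, 0) = 0 := (hm (i, 0)).2 (by dsimp only; omega)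
        simp [nIncl, hi, hmi]
    exact ⟨g, hg, hgT⟩

end BCOV
end
end

section
/- For all homogeneous divergence-free polynomial polyvector fields α, β, γ on ℂ^d one has σ(∂(∂(αβ)·γ)) + (−1)^{|α|} σ(∂(α·∂(βγ))) + (−1)^{(|α|+1)|β|} σ(∂(β·∂(αγ))) = 0. (This is the 2-cocycle identity for the pairing c(α,β) = σ(∂(αβ)), the constant term of the Schouten–Nijenhuis bracket, which exhibits the kernel of the divergence as a one-dimensional central extension of SHO′(d|d); it underlies the minimal model of minimal BCOV theory on ℂ^d.) -/
/-!
Setup: the supercommutative algebra `A = ℂ[x_1,…,x_d] ⊗ Λ[ξ_1,…,ξ_d]`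
of polynomial polyvector fields on `ℂ^d`, encoded by coefficients: an element
`f : PVA d` assigns to each finite set `S ⊆ Fin d` the polynomial coefficient
of the monomial `ξ_S` (the product of the `ξ_i`, `i ∈ S`, in increasing order).
-/

noncomputable section

namespace BCOV

variable {d : ℕ}

lemma koszulSign_union_left {T T' : Finset (Fin d)} (h : Disjoint T T') (U : Finset (Fin d)) :
    koszulSign (T ∪ T') U = koszulSign T U * koszulSign T' U := by
  unfold koszulSign
  rw [Finset.union_product, Finset.filter_union, Finset.card_union_of_disjoint, pow_add]
  exact Finset.disjoint_filter_filter (Finset.disjoint_product.2 (Or.inl h))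

lemma koszulSign_union_right (T : Finset (Fin d)) {U U' : Finset (Fin d)} (h : Disjoint U U') :
    koszulSign T (U ∪ U') = koszulSign T U * koszulSign T U' := by
  unfold koszulSign
  rw [Finset.product_union, Finset.filter_union, Finset.card_union_of_disjoint, pow_add]
  exact Finset.disjoint_filter_filter (Finset.disjoint_product.2 (Or.inr h))

lemma koszulSign_mul_self (T U : Finset (Fin d)) : koszulSign T U * koszulSign T U = 1 := by
  unfold koszulSign
  rw [← mul_pow]; simp

lemma koszulSign_mul_swap {T U : Finset (Fin d)} (h : Disjoint T U) :
    koszulSign T U * koszulSign U T = (-1) ^ (T.card * U.card) := by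
  have hU : ((U ×ˢ T).filter fun p : Fin d × Fin d => p.2 < p.1).card =
      ((T ×ˢ U).filter fun p : Fin d × Fin d => ¬ p.2 < p.1).card := by
    refine Finset.card_bij' (fun p _ => p.swap) (fun p _ => p.swap) ?_ ?_ ?_ ?_
    · rintro ⟨u, t⟩ hp
      simp only [Finset.mem_filter, Finset.mem_product, Prod.swap] at hp ⊢
      exact ⟨hp.1.symm, hp.2.not_gt⟩
    · rintro ⟨t, u⟩ hp
      simp only [Finset.mem_filter, Finset.mem_product, Prod.swap] at hp ⊢
      exact ⟨hp.1.symm, lt_of_le_of_ne (not_lt.1 hp.2)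
        (Finset.disjoint_left.1 h hp.1.1 <| · ▸ hp.1.2)⟩
    · simp
    · simp
  unfold koszulSign
  rw [hU, ← pow_add, Finset.card_filter_add_card_filter_not, Finset.card_product]

lemma koszulSign_singleton (i : Fin d) (U : Finset (Fin d)) :
    koszulSign {i} U = (-1) ^ (U.filter fun j => j < i).card := by
  unfold koszulSign
  rw [Finset.singleton_product, Finset.filter_map, Finset.card_map]
  rfl

lemma koszulSign_insert_left {i : Fin d} {T : Finset (Fin d)} (h : i ∉ T) (U : Finset (Fin d)) :
    koszulSign (insert i T) U = koszulSign {i} U * koszulSign T U := by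
  rw [Finset.insert_eq, koszulSign_union_left (Finset.disjoint_singleton_left.2 h)]

lemma koszulSign_insert_right {i : Fin d} (T : Finset (Fin d)) {U : Finset (Fin d)} (h : i ∉ U) :
    koszulSign T (insert i U) = koszulSign T {i} * koszulSign T U := by
  rw [Finset.insert_eq, koszulSign_union_right T (Finset.disjoint_singleton_left.2 h)]

lemma koszulSign_swap_singleton {i : Fin d} {T : Finset (Fin d)} (h : i ∉ T) :
    koszulSign T {i} = (-1) ^ T.card * koszulSign {i} T := by
  have h1 := koszulSign_mul_swap (Finset.disjoint_singleton_right.2 h)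
  rw [Finset.card_singleton, mul_one] at h1
  rw [← h1, mul_assoc, koszulSign_mul_self, mul_one]

lemma Dxi_of_mem {i : Fin d} {S : Finset (Fin d)} (h : i ∈ S) (f : PVA d) : Dxi i f S = 0 :=
  if_pos h

lemma Dxi_of_notMem {i : Fin d} {S : Finset (Fin d)} (h : i ∉ S) (f : PVA d) :
    Dxi i f S = koszulSign {i} S • f (insert i S) := by
  rw [koszulSign_singleton]
  exact if_neg h

/-- The product of `A` as a bilinear map. -/
def mulBilin (d : ℕ) : PVA d →ₗ[ℂ] PVA d →ₗ[ℂ] PVA d :=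
  LinearMap.mk₂ ℂ mul
    (fun f f' g => by
      funext S
      simp [mul, add_mul, Finset.sum_add_distrib])
    (fun z f g => by
      funext S
      simp [mul, Finset.smul_sum, smul_comm z])
    (fun f g g' => by
      funext S
      simp [mul, mul_add, Finset.sum_add_distrib])
    (fun z f g => by
      funext S
      simp [mul, Finset.smul_sum, smul_comm z])

lemma mulBilin_apply (f g : PVA d) : mulBilin d f g = mul f g := rfl

/-- `∂/∂x_i` as a linear map. -/
def DxLin (i : Fin d) : PVA d →ₗ[ℂ] PVA d where
  toFun := Dx i
  map_add' f g := by
    funext S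
    simp [Dx]
  map_smul' z f := by
    funext S
    simp [Dx]

/-- `∂/∂ξ_i` as a linear map. -/
def DxiLin (i : Fin d) : PVA d →ₗ[ℂ] PVA d where
  toFun := Dxi i
  map_add' f g := by
    funext S
    by_cases h : i ∈ S
    · simp [Dxi_of_mem h]
    · simp [Dxi_of_notMem h]
  map_smul' z f := by
    funext S
    by_cases h : i ∈ S
    · simp [Dxi_of_mem h]
    · simp [Dxi_of_notMem h, smul_comm z]

lemma DxLin_apply (i : Fin d) (f : PVA d) : DxLin i f = Dx i f := rfl

lemma DxiLin_apply (i : Fin d) (f : PVA d) : DxiLin i f = Dxi i f := rfl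

lemma mul_mul_assoc (f g h : PVA d) : mul (mul f g) h = mul f (mul g h) := by
  funext S
  simp only [mul, Finset.sum_mul, Finset.mul_sum, Finset.smul_sum]
  rw [Finset.sum_sigma', Finset.sum_sigma']
  refine Finset.sum_bij' (fun p _ => ⟨p.2, p.1 \ p.2⟩) (fun p _ => ⟨p.1 ∪ p.2, p.1⟩) ?_ ?_ ?_ ?_ ?_
  · rintro ⟨V, T⟩ hp
    simp only [Finset.mem_sigma, Finset.mem_powerset] at hp ⊢
    exact ⟨hp.2.trans hp.1, Finset.sdiff_subset_sdiff hp.1 le_rfl⟩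
  · rintro ⟨T, W⟩ hp
    simp only [Finset.mem_sigma, Finset.mem_powerset] at hp ⊢
    exact ⟨Finset.union_subset hp.1 (hp.2.trans Finset.sdiff_subset), Finset.subset_union_left⟩
  · rintro ⟨V, T⟩ hp
    simp only [Finset.mem_sigma, Finset.mem_powerset] at hp
    simp [Finset.union_eq_right.2 hp.2]
  · rintro ⟨T, W⟩ hp
    simp only [Finset.mem_sigma, Finset.mem_powerset] at hp
    have : Disjoint W T := Finset.disjoint_of_subset_left hp.2 Finset.sdiff_disjoint
    simp [Finset.union_sdiff_cancel_left this.symm]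
  · rintro ⟨V, T⟩ hp
    simp only [Finset.mem_sigma, Finset.mem_powerset] at hp
    obtain ⟨hV, hT⟩ := hp
    have e1 : (S \ T) \ (V \ T) = S \ V := by
      ext x; have := @hT x; simp only [Finset.mem_sdiff]; tauto
    have e2 : S \ T = (V \ T) ∪ (S \ V) := by
      ext x; have := @hT x; have := @hV x
      simp only [Finset.mem_sdiff, Finset.mem_union]; tauto
    have e3 : koszulSign V (S \ V) = koszulSign T (S \ V) * koszulSign (V \ T) (S \ V) := by
      rw [← koszulSign_union_left Finset.disjoint_sdiff, Finset.union_sdiff_of_subset hT]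
    have e4 : koszulSign T (S \ T) = koszulSign T (V \ T) * koszulSign T (S \ V) := by
      rw [e2, koszulSign_union_right]
      exact Finset.disjoint_of_subset_left Finset.sdiff_subset Finset.disjoint_sdiff
    simp only [e1, smul_mul_assoc, mul_smul_comm, smul_smul, mul_assoc]
    rw [e3, e4]
    congr 1
    ring

lemma Dx_mul (i : Fin d) (f g : PVA d) : Dx i (mul f g) = mul (Dx i f) g + mul f (Dx i g) := by
  funext S
  simp only [Dx, mul, map_sum, Pi.add_apply, ← Finset.sum_add_distrib]
  refine Finset.sum_congr rfl fun T _ => ?_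
  rw [Derivation.map_smul, Derivation.leibniz, ← smul_add]
  simp only [smul_eq_mul]
  congr 1
  ring

/-- Only coefficients of `ξ`-monomials whose length has the parity of `a` occur in `f`. -/
def HasParity (a : ℕ) (f : PVA d) : Prop :=
  ∀ S : Finset (Fin d), f S ≠ 0 → (-1 : ℂ) ^ S.card = (-1) ^ a

lemma IsHomog.hasParity {a : ℕ} {f : PVA d} (h : IsHomog a f) : HasParity a f := fun S hS => by
  rw [not_imp_comm.1 (h S) hS]

lemma HasParity.mul {a b : ℕ} {f g : PVA d} (hf : HasParity a f) (hg : HasParity b g) :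
    HasParity (a + b) (mul f g) := fun S hS => by
  obtain ⟨T, hT, h⟩ := Finset.exists_ne_zero_of_sum_ne_zero hS
  have h2 := right_ne_zero_of_smul h
  rw [pow_add, ← hf T (left_ne_zero_of_mul h2), ← hg _ (right_ne_zero_of_mul h2), ← pow_add,
    add_comm, Finset.card_sdiff_add_card_eq_card (Finset.mem_powerset.1 hT)]

lemma HasParity.Dx {a : ℕ} {f : PVA d} (hf : HasParity a f) (i : Fin d) :
    HasParity a (Dx i f) := fun S hS => by
  refine hf S fun h => hS ?_
  simp [BCOV.Dx, h]

lemma HasParity.Dxi {a : ℕ} {f : PVA d} (hf : HasParity a f) (i : Fin d) :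
    HasParity (a + 1) (Dxi i f) := fun S hS => by
  have hi : i ∉ S := fun h => hS (Dxi_of_mem h f)
  rw [Dxi_of_notMem hi] at hS
  have h := hf _ (right_ne_zero_of_smul hS)
  rw [Finset.card_insert_of_notMem hi] at h
  rw [pow_succ, ← h]
  ring

lemma mul_graded_comm {a b : ℕ} {f g : PVA d} (hf : HasParity a f) (hg : HasParity b g) :
    mul f g = ((-1 : ℂ) ^ (a * b)) • mul g f := by
  funext S
  simp only [mul, Pi.smul_apply, Finset.smul_sum]
  refine Finset.sum_bij' (fun T _ => S \ T) (fun T _ => S \ T) ?_ ?_ ?_ ?_ ?_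
  · simp
  · simp
  · intro T hT
    simpa using hT
  · intro T hT
    simpa using hT
  · intro T hT
    rw [Finset.sdiff_sdiff_eq_self (Finset.mem_powerset.1 hT), smul_smul, mul_comm (g _)]
    by_cases h1 : f T = 0
    · simp [h1]
    by_cases h2 : g (S \ T) = 0
    · simp [h2]
    congr 1
    rw [pow_mul, ← hf T h1, ← pow_mul, mul_comm T.card, pow_mul, ← hg _ h2, ← pow_mul,
      mul_comm, mul_comm, ← koszulSign_mul_swap Finset.sdiff_disjoint, mul_right_comm,
      koszulSign_mul_self, one_mul]

lemma Dxi_mul {a : ℕ} {f : PVA d} (hf : HasParity a f) (i : Fin d) (g : PVA d) :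
    Dxi i (mul f g) = mul (Dxi i f) g + ((-1 : ℂ) ^ a) • mul f (Dxi i g) := by
  funext S
  by_cases hi : i ∈ S
  · obtain ⟨R, hR, rfl⟩ : ∃ R, i ∉ R ∧ insert i R = S :=
      ⟨S.erase i, Finset.notMem_erase i S, Finset.insert_erase hi⟩
    rw [Dxi_of_mem hi]
    simp only [mul, Pi.add_apply, Pi.smul_apply, Finset.smul_sum, Finset.sum_powerset_insert hR,
      ← Finset.sum_add_distrib]
    refine (Finset.sum_eq_zero fun T hT => ?_).symm
    rw [Finset.mem_powerset] at hT
    have hiT : i ∉ T := fun h => hR (hT h)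
    have hiU : i ∉ R \ T := fun h => hR (Finset.mem_sdiff.1 h).1
    rw [Finset.insert_sdiff_of_notMem _ hiT, Finset.insert_sdiff_insert,
      Finset.sdiff_insert_of_notMem hR, Dxi_of_notMem hiT, Dxi_of_notMem hiU,
      Dxi_of_mem (Finset.mem_insert_self i T), Dxi_of_mem (Finset.mem_insert_self i (R \ T)),
      koszulSign_insert_left hiT, koszulSign_insert_right _ hiU, koszulSign_swap_singleton hiT]
    by_cases h : f (insert i T) = 0
    · simp [h]
    have ha := hf _ h
    rw [Finset.card_insert_of_notMem hiT] at ha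
    have hTT := koszulSign_mul_self {i} T
    have hUU := koszulSign_mul_self {i} (R \ T)
    simp only [smul_mul_assoc, mul_smul_comm, smul_smul, zero_mul, mul_zero, smul_zero, add_zero,
      zero_add, ← add_smul, ← ha]
    convert zero_smul ℂ _
    linear_combination ((-1) ^ T.card * koszulSign T (R \ T)) * (hTT - hUU)
  · rw [Dxi_of_notMem hi]
    simp only [mul, Pi.add_apply, Pi.smul_apply, Finset.smul_sum, Finset.sum_powerset_insert hi,
      ← Finset.sum_add_distrib]
    refine Finset.sum_congr rfl fun T hT => ?_
    rw [Finset.mem_powerset] at hT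
    have hiT : i ∉ T := fun h => hi (hT h)
    have hiU : i ∉ S \ T := fun h => hi (Finset.mem_sdiff.1 h).1
    have hS : koszulSign {i} S = koszulSign {i} T * koszulSign {i} (S \ T) := by
      rw [← koszulSign_union_right _ Finset.disjoint_sdiff, Finset.union_sdiff_of_subset hT]
    have hTT := koszulSign_mul_self {i} T
    have hUU := koszulSign_mul_self {i} (S \ T)
    rw [Finset.insert_sdiff_of_notMem _ hiT, Finset.insert_sdiff_insert,
      Finset.sdiff_insert_of_notMem hi, Dxi_of_notMem hiT, Dxi_of_notMem hiU,
      koszulSign_insert_left hiT, koszulSign_insert_right _ hiU, koszulSign_swap_singleton hiT, hS]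
    simp only [smul_mul_assoc, mul_smul_comm, smul_smul, smul_add]
    rw [add_comm]
    congr 1
    · congr 1
      linear_combination (koszulSign {i} T * koszulSign T (S \ T)) * hUU
    · by_cases h : f T = 0
      · simp [h]
      rw [← hf T h]
      congr 1
      linear_combination
        ((-1) ^ T.card * koszulSign {i} (S \ T) * koszulSign T (S \ T)) * hTT

/-- The failure of the divergence to be a derivation on `f · g`, for `f` of parity `a`. -/
def dvgDefect (a : ℕ) (f g : PVA d) : PVA d :=
  ∑ i, (mul (Dxi i f) (Dx i g) + ((-1 : ℂ) ^ a) • mul (Dx i f) (Dxi i g))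

lemma dvg_mul {a : ℕ} {f : PVA d} (hf : HasParity a f) (g : PVA d) :
    dvg (mul f g) = mul (dvg f) g + ((-1 : ℂ) ^ a) • mul f (dvg g) + dvgDefect a f g := by
  simp only [dvg, dvgDefect, ← mulBilin_apply, map_sum, LinearMap.sum_apply, Finset.smul_sum,
    ← Finset.sum_add_distrib]
  refine Finset.sum_congr rfl fun i _ => ?_
  simp only [mulBilin_apply]
  rw [Dxi_mul hf, ← DxLin_apply, map_add, map_smul]
  simp only [DxLin_apply, Dx_mul]
  module

lemma dvgDefect_mul {a b : ℕ} {f g : PVA d} (hf : HasParity a f) (hg : HasParity b g)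
    (h : PVA d) :
    dvgDefect (a + b) (mul f g) h = ((-1 : ℂ) ^ a) • mul f (dvgDefect b g h) +
      ((-1 : ℂ) ^ ((a + 1) * b)) • mul g (dvgDefect a f h) := by
  simp only [dvgDefect, ← mulBilin_apply, map_sum, Finset.smul_sum, ← Finset.sum_add_distrib]
  refine Finset.sum_congr rfl fun i _ => ?_
  simp only [mulBilin_apply]
  rw [Dxi_mul hf, Dx_mul]
  rw [mul_graded_comm (hf.Dxi i) hg, mul_graded_comm (hf.Dx i) hg]
  simp only [← mulBilin_apply, map_add, map_smul, LinearMap.add_apply, LinearMap.smul_apply]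
  simp only [mulBilin_apply, mul_mul_assoc]
  have hs : (-1 : ℂ) ^ ((a + 1) * b) = (-1) ^ (a * b) * (-1) ^ b := by
    rw [← pow_add]; ring
  simp only [hs, pow_add]
  module

lemma dvg_mul_mul {a b : ℕ} {f g h : PVA d} (hf : HasParity a f) (hg : HasParity b g)
    (hdf : dvg f = 0) (hdg : dvg g = 0) (hdh : dvg h = 0) :
    dvg (mul (mul f g) h) = mul (dvg (mul f g)) h + ((-1 : ℂ) ^ a) • mul f (dvg (mul g h)) +
      ((-1 : ℂ) ^ ((a + 1) * b)) • mul g (dvg (mul f h)) := by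
  have h0 : ∀ k : PVA d, mul 0 k = 0 := fun k => by simp [← mulBilin_apply]
  have h1 : ∀ k : PVA d, mul k 0 = 0 := fun k => by simp [← mulBilin_apply]
  rw [dvg_mul (hf.mul hg), dvgDefect_mul hf hg, dvg_mul hg h, dvg_mul hf h, hdf, hdg, hdh]
  simp only [h0, h1, smul_zero, add_zero, zero_add, add_assoc]

/-- The divergence as a linear map. -/
def dvgLin (d : ℕ) : PVA d →ₗ[ℂ] PVA d := ∑ i, DxLin i ∘ₗ DxiLin i

lemma dvgLin_apply (f : PVA d) : dvgLin d f = dvg f := by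
  simp [dvgLin, dvg, DxLin_apply, DxiLin_apply]

/-- For all homogeneous divergence-free polynomial polyvector
fields `α, β, γ` on `ℂ^d` one has
`σ(∂(∂(αβ)·γ)) + (−1)^{|α|} σ(∂(α·∂(βγ))) + (−1)^{(|α|+1)|β|} σ(∂(β·∂(αγ))) = 0`.
(This is the 2-cocycle identity for the pairing `c(α,β) = σ(∂(αβ))`, the
constant term of the Schouten–Nijenhuis bracket, which exhibits the kernel of
the divergence as a one-dimensional central extension of `SHO′(d|d)`.) -/
theorem sigma_cocycle (d : ℕ) (hd : 1 ≤ d) (a b c : ℕ) (α β γ : PVA d)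
    (hα0 : α ≠ 0) (hβ0 : β ≠ 0) (hγ0 : γ ≠ 0)
    (hα : IsHomog a α) (hβ : IsHomog b β) (hγ : IsHomog c γ)
    (hdα : dvg α = 0) (hdβ : dvg β = 0) (hdγ : dvg γ = 0) :
    sigmaA (dvg (mul (dvg (mul α β)) γ)) +
        ((-1 : ℂ) ^ a) * sigmaA (dvg (mul α (dvg (mul β γ)))) +
        ((-1 : ℂ) ^ ((a + 1) * b)) * sigmaA (dvg (mul β (dvg (mul α γ)))) = 0 := by
  have h := congrArg dvg (dvg_mul_mul hα.hasParity hβ.hasParity hdα hdβ hdγ)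
  rw [dvg_dvg] at h
  simp only [← dvgLin_apply, map_add, map_smul] at h
  simp only [dvgLin_apply] at h
  have hsigma := congrArg sigmaA h
  simpa [sigmaA, MvPolynomial.smul_eq_C_mul] using hsigma.symm

end BCOV
end
end

section
/- Let d = 3 and let V ⊂ A be the ℂ-linear span of {x_1, x_2, x_3, ξ_1, ξ_2, ξ_3, ξ_iξ_j (1 ≤ i < j ≤ 3)}. Define linear maps T_e, T_h, T_f : V → A on this basis by: T_h(x_i) = −x_i, T_h(ξ_i) = 0, T_h(ξ_iξ_j) = ξ_iξ_j; T_e(x_i) = ∂_{ξ_i}(ξ_1ξ_2ξ_3) (so T_e(x_1) = ξ_2ξ_3, T_e(x_2) = −ξ_1ξ_3, T_e(x_3) = ξ_1ξ_2), T_e(ξ_i) = 0, T_e(ξ_iξ_j) = 0; T_f(x_i) = 0, T_f(ξ_i) = 0, T_f(ξ_iξ_j) = Σ_l ε_{ijl} x_l with ε the Levi-Civita symbol. Define the ℂ²-valued pairing c(α,β) = (c_1(α,β), c_2(α,β)) := (τ(αβ), σ(∂(αβ))). Then for all α, β ∈ V: c(T_e α, β) + c(α, T_e β) = (c_2(α,β),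 0), c(T_h α, β) + c(α, T_h β) = (c_1(α,β), −c_2(α,β)), and c(T_f α, β) + c(α, T_f β) = (0, c_1(α,β)). That is, the cocycle c is equivariant for the sl_2-action by T_e, T_h, T_f with ℂ² carrying the standard representation; this is the equivariance that extends the sl_2-action on SHO(3|3) by outer derivations, expressed in the Hamiltonian model, to its odd two-dimensional central extension. -/
/-!
Setup: the supercommutative algebra `A = ℂ[x_1,…,x_d] ⊗ Λ[ξ_1,…,ξ_d]`
of polynomial polyvector fields on `ℂ^d`, encoded by coefficients: an element
`f : PVA d` assigns to each finite set `S ⊆ Fin d` the polynomial coefficient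
of the monomial `ξ_S` (the product of the `ξ_i`, `i ∈ S`, in increasing order).
-/

noncomputable section

namespace BCOV

variable {d : ℕ}

/-- The element `x_i ∈ A` (for `d = 3`). -/
def xE (i : Fin 3) : PVA 3 := fun S => if S = ∅ then MvPolynomial.X i else 0

/-- The element `ξ_i ∈ A` (for `d = 3`). -/
def xiE (i : Fin 3) : PVA 3 := fun S => if S = {i} then 1 else 0

/-- The element `ξ_i ξ_j ∈ A` (for `i < j`, `d = 3`). -/
def xiE2 (i j : Fin 3) : PVA 3 := fun S => if S = {i, j} then 1 else 0

/-- The general element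
`Σ_i a_i x_i + Σ_i b_i ξ_i + Σ_{i<j} c_{ij} ξ_iξ_j` of the subspace
`V = span{x_1, x_2, x_3, ξ_1, ξ_2, ξ_3, ξ_iξ_j (i < j)} ⊆ A`. -/
def elt (a b : Fin 3 → ℂ) (c : Fin 3 → Fin 3 → ℂ) : PVA 3 :=
  (∑ i : Fin 3, a i • xE i) + (∑ i : Fin 3, b i • xiE i) +
    ∑ i : Fin 3, ∑ j : Fin 3, if i < j then c i j • xiE2 i j else 0

/-- `T_e` applied to the element of `V` with coefficients `(a, b, c)`:
`T_e(x_i) = ∂_{ξ_i}(ξ_1ξ_2ξ_3)` (so `T_e(x_1) = ξ_2ξ_3`,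
`T_e(x_2) = −ξ_1ξ_3`, `T_e(x_3) = ξ_1ξ_2`), `T_e(ξ_i) = 0`, `T_e(ξ_iξ_j) = 0`. -/
def Te (a : Fin 3 → ℂ) : PVA 3 :=
  a 0 • xiE2 1 2 - a 1 • xiE2 0 2 + a 2 • xiE2 0 1

/-- `T_h` applied to the element of `V` with coefficients `(a, b, c)`:
`T_h(x_i) = −x_i`, `T_h(ξ_i) = 0`, `T_h(ξ_iξ_j) = ξ_iξ_j`. -/
def Th (a : Fin 3 → ℂ) (c : Fin 3 → Fin 3 → ℂ) : PVA 3 :=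
  -(∑ i : Fin 3, a i • xE i) +
    ∑ i : Fin 3, ∑ j : Fin 3, if i < j then c i j • xiE2 i j else 0

/-- `T_f` applied to the element of `V` with coefficients `(a, b, c)`:
`T_f(x_i) = 0`, `T_f(ξ_i) = 0`, `T_f(ξ_iξ_j) = Σ_l ε_{ijl} x_l` with `ε` the
Levi-Civita symbol. -/
def Tf (c : Fin 3 → Fin 3 → ℂ) : PVA 3 :=
  c 0 1 • xE 2 - c 0 2 • xE 1 + c 1 2 • xE 0

/-- First component of the `ℂ²`-valued pairing: `c_1(α,β) = τ(αβ)`. -/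
def c1p (α β : PVA 3) : ℂ := tauA (mul α β)

/-- Second component of the `ℂ²`-valued pairing: `c_2(α,β) = σ(∂(αβ))`. -/
def c2p (α β : PVA 3) : ℂ := sigmaA (dvg (mul α β))

lemma koszulSign_empty_left (T : Finset (Fin d)) : koszulSign ∅ T = 1 := by
  simp [koszulSign]

lemma koszulSign_empty_right (T : Finset (Fin d)) : koszulSign T ∅ = 1 := by
  simp [koszulSign]

lemma mul_singleton (f g : PVA d) (i : Fin d) :
    mul f g {i} = f ∅ * g {i} + f {i} * g ∅ := by
  have h : ({i} : Finset (Fin d)).powerset = {∅, {i}} := by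
    ext T; simp [Finset.subset_singleton_iff]
  have hne : (∅ : Finset (Fin d)) ≠ {i} := (Finset.singleton_ne_empty i).symm
  simp [mul, h, Finset.sum_pair hne, koszulSign_empty_left, koszulSign_empty_right]

lemma c2p_eq_sum (f g : PVA 3) :
    c2p f g = ∑ i, MvPolynomial.constantCoeff
      (MvPolynomial.pderiv i (f ∅ * g {i} + f {i} * g ∅)) := by
  simp [c2p, sigmaA, dvg, Dx, Dxi, mul_singleton, Finset.sum_apply]

lemma mul_univ_fin_three (f g : PVA 3) :
    mul f g Finset.univ =
      f ∅ * g Finset.univ + f Finset.univ * g ∅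
        + (f {0} * g {1, 2} - f {1} * g {0, 2} + f {2} * g {0, 1})
        + (f {1, 2} * g {0} - f {0, 2} * g {1} + f {0, 1} * g {2}) := by
  have h : (Finset.univ : Finset (Fin 3)).powerset =
      {∅, {0}, {1}, {2}, {0, 1}, {0, 2}, {1, 2}, Finset.univ} := by decide
  have e0 : (Finset.univ \ {0} : Finset (Fin 3)) = {1, 2} := by decide
  have e1 : (Finset.univ \ {1} : Finset (Fin 3)) = {0, 2} := by decide
  have e2 : (Finset.univ \ {2} : Finset (Fin 3)) = {0, 1} := by decide
  have e01 : (Finset.univ \ {0, 1} : Finset (Fin 3)) = {2} := by decide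
  have e02 : (Finset.univ \ {0, 2} : Finset (Fin 3)) = {1} := by decide
  have e12 : (Finset.univ \ {1, 2} : Finset (Fin 3)) = {0} := by decide
  have sign {T U : Finset (Fin 3)} (n : ℕ)
      (hn : ((T ×ˢ U).filter fun p : Fin 3 × Fin 3 => p.2 < p.1).card = n) :
      koszulSign T U = (-1) ^ n := by rw [koszulSign, hn]
  have s0 : koszulSign ({0} : Finset (Fin 3)) {1, 2} = (-1) ^ 0 := sign 0 (by decide)
  have s1 : koszulSign ({1} : Finset (Fin 3)) {0, 2} = (-1) ^ 1 := sign 1 (by decide)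
  have s2 : koszulSign ({2} : Finset (Fin 3)) {0, 1} = (-1) ^ 2 := sign 2 (by decide)
  have s01 : koszulSign ({0, 1} : Finset (Fin 3)) {2} = (-1) ^ 0 := sign 0 (by decide)
  have s02 : koszulSign ({0, 2} : Finset (Fin 3)) {1} = (-1) ^ 1 := sign 1 (by decide)
  have s12 : koszulSign ({1, 2} : Finset (Fin 3)) {0} = (-1) ^ 2 := sign 2 (by decide)
  rw [mul, h]
  repeat rw [Finset.sum_insert (by decide)]
  rw [Finset.sum_singleton, e0, e1, e2, e01, e02, e12, s0, s1, s2, s01, s02, s12]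
  simp only [Finset.sdiff_empty, Finset.sdiff_self, koszulSign_empty_left,
    koszulSign_empty_right, pow_zero, pow_one, neg_one_sq, one_smul, neg_one_smul]
  ring

lemma elt_empty (a b : Fin 3 → ℂ) (c : Fin 3 → Fin 3 → ℂ) :
    elt a b c ∅ = ∑ i, a i • MvPolynomial.X i := by
  simp [elt, Fin.sum_univ_three, xE, xiE, xiE2, Finset.empty_ne_singleton,
    (Finset.insert_ne_empty _ _).symm]

lemma elt_singleton (a b : Fin 3 → ℂ) (c : Fin 3 → Fin 3 → ℂ) (i : Fin 3) :
    elt a b c {i} = MvPolynomial.C (b i) := by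
  have h (j k l : Fin 3) (hkl : k < l) : ({j} : Finset (Fin 3)) ≠ {k, l} := by
    revert j k l; decide
  fin_cases i <;>
    simp [elt, Fin.sum_univ_three, xE, xiE, xiE2, h, MvPolynomial.smul_eq_C_mul]

lemma elt_pair (a b : Fin 3 → ℂ) (c : Fin 3 → Fin 3 → ℂ) {i j : Fin 3} (hij : i < j) :
    elt a b c {i, j} = MvPolynomial.C (c i j) := by
  have h1 (k : Fin 3) : ({i, j} : Finset (Fin 3)) ≠ {k} := by
    revert i j k; decide
  have h2 (k l : Fin 3) (hkl : k < l) :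
      ({i, j} : Finset (Fin 3)) = {k, l} ↔ i = k ∧ j = l := by
    revert i j k l; decide
  revert hij
  fin_cases i <;> fin_cases j <;> intro hij <;>
    simp_all [elt, Fin.sum_univ_three, xE, xiE, xiE2, MvPolynomial.smul_eq_C_mul]

lemma elt_univ (a b : Fin 3 → ℂ) (c : Fin 3 → Fin 3 → ℂ) :
    elt a b c Finset.univ = 0 := by
  have h1 (k : Fin 3) : (Finset.univ : Finset (Fin 3)) ≠ {k} := by
    revert k; decide
  have h2 (k l : Fin 3) : (Finset.univ : Finset (Fin 3)) ≠ {k, l} := by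
    revert k l; decide
  simp [elt, Fin.sum_univ_three, xE, xiE, xiE2, h1, h2,
    Finset.univ_nonempty.ne_empty]

lemma c1p_elt (a b a' b' : Fin 3 → ℂ) (c c' : Fin 3 → Fin 3 → ℂ) :
    c1p (elt a b c) (elt a' b' c') =
      (b 0 * c' 1 2 - b 1 * c' 0 2 + b 2 * c' 0 1)
        + (c 1 2 * b' 0 - c 0 2 * b' 1 + c 0 1 * b' 2) := by
  have h01 : (0 : Fin 3) < 1 := by decide
  have h02 : (0 : Fin 3) < 2 := by decide
  have h12 : (1 : Fin 3) < 2 := by decide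
  simp [c1p, tauA, mul_univ_fin_three, elt_univ, elt_singleton, elt_pair _ _ _ h01,
    elt_pair _ _ _ h02, elt_pair _ _ _ h12]

lemma c2p_elt (a b a' b' : Fin 3 → ℂ) (c c' : Fin 3 → Fin 3 → ℂ) :
    c2p (elt a b c) (elt a' b' c') = ∑ i, (a i * b' i + b i * a' i) := by
  have hX (u : Fin 3 → ℂ) (i : Fin 3) : MvPolynomial.constantCoeff
      (MvPolynomial.pderiv i (∑ j, u j • MvPolynomial.X j : MPoly 3)) = u i := by
    simp [MvPolynomial.pderiv_X, Pi.single_apply, apply_ite, MvPolynomial.constantCoeff_smul]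
  rw [c2p_eq_sum]
  refine Finset.sum_congr rfl fun i _ => ?_
  rw [elt_empty, elt_empty, elt_singleton, elt_singleton, map_add, Derivation.leibniz,
    Derivation.leibniz, MvPolynomial.pderiv_C, MvPolynomial.pderiv_C]
  simp only [smul_eq_mul, map_zero, map_add, map_mul, hX,
    MvPolynomial.constantCoeff_C]
  ring

lemma Te_eq_elt (a : Fin 3 → ℂ) :
    Te a = elt 0 0 ![![0, a 2, -a 1], ![0, 0, a 0], 0] := by
  simp [Te, elt, Fin.sum_univ_three]
  abel

lemma Th_eq_elt (a : Fin 3 → ℂ) (c : Fin 3 → Fin 3 → ℂ) : Th a c = elt (-a) 0 c := by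
  simp [Th, elt]

lemma Tf_eq_elt (c : Fin 3 → Fin 3 → ℂ) :
    Tf c = elt ![c 1 2, -c 0 2, c 0 1] 0 0 := by
  simp [Tf, elt, Fin.sum_univ_three]
  abel

/-- For all `α, β ∈ V` (with coefficients `(a,b,c)` and
`(a',b',c')` respectively), the `ℂ²`-valued cocycle
`c(α,β) = (c_1(α,β), c_2(α,β)) = (τ(αβ), σ(∂(αβ)))` is equivariant for the
`sl_2`-action by `T_e, T_h, T_f` with `ℂ²` carrying the standard
representation:
`c(T_e α, β) + c(α, T_e β) = (c_2(α,β), 0)`,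
`c(T_h α, β) + c(α, T_h β) = (c_1(α,β), −c_2(α,β))`, and
`c(T_f α, β) + c(α, T_f β) = (0, c_1(α,β))`.
This is the equivariance that extends the `sl_2`-action on `SHO(3|3)` by outer
derivations, expressed in the Hamiltonian model, to its odd two-dimensional
central extension. -/
theorem sl2_cocycle_equivariance (a b : Fin 3 → ℂ) (c : Fin 3 → Fin 3 → ℂ)
    (a' b' : Fin 3 → ℂ) (c' : Fin 3 → Fin 3 → ℂ) :
    (c1p (Te a) (elt a' b' c') + c1p (elt a b c) (Te a') =
        c2p (elt a b c) (elt a' b' c') ∧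
      c2p (Te a) (elt a' b' c') + c2p (elt a b c) (Te a') = 0) ∧
    (c1p (Th a c) (elt a' b' c') + c1p (elt a b c) (Th a' c') =
        c1p (elt a b c) (elt a' b' c') ∧
      c2p (Th a c) (elt a' b' c') + c2p (elt a b c) (Th a' c') =
        -c2p (elt a b c) (elt a' b' c')) ∧
    (c1p (Tf c) (elt a' b' c') + c1p (elt a b c) (Tf c') = 0 ∧
      c2p (Tf c) (elt a' b' c') + c2p (elt a b c) (Tf c') =
        c1p (elt a b c) (elt a' b' c')) := by
  simp only [Te_eq_elt, Th_eq_elt, Tf_eq_elt, c1p_elt, c2p_elt, Fin.sum_univ_three]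
  refine ⟨⟨?_, ?_⟩, ⟨?_, ?_⟩, ⟨?_, ?_⟩⟩ <;> simp <;> ring

end BCOV
end
end
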